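/- If a geometric complete multipartite graph H contains a non-rainbow plane cycle, then its point set P (with coloring φ) contains at least one of the configurations C1, C2, C3, C4. -/

import Mathlib

noncomputable section

/-- Points of the plane. -/
abbrev Pt : Type := ℝ × ℝ

/-- Signed side of point `p` with respect to the oriented line through `u` and `u'`
(the usual cross-product / determinant test). -/
def sideSign (u u' p : Pt) : ℝ :=
  (u'.1 - u.1) * (p.2 - u.2) - (u'.2 - u.2) * (p.1 - u.1)

/-- `v` and `v'` lie on strictly opposite sides of the straight line through `u` and `u'`. -/
def StrictlyOppositeSides (u u' v v' : Pt) : Prop :=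
  sideSign u u' v * sideSign u u' v' < 0

/-- A set of points is in general position: no three (distinct) points of it are collinear. -/
def GenPos (P : Set Pt) : Prop :=
  ∀ a ∈ P, ∀ b ∈ P, ∀ c ∈ P, a ≠ b → a ≠ c → b ≠ c →
    ¬ Collinear ℝ ({a, b, c} : Set Pt)

/-- `γ : ZMod t → Pt` is a plane cycle of length `t` for the coloring `φ`:
a cyclic sequence of `t ≥ 3` distinct points in which cyclically consecutive points have
different colors, and in which two distinct edges meet exactly in their common endpoint
if they are cyclically consecutive, and not at all otherwise. -/
def IsPlaneCycle (φ : Pt → ℕ) (t : ℕ) (γ : ZMod t → Pt) : Prop :=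
  3 ≤ t ∧ Function.Injective γ ∧
  (∀ i : ZMod t, φ (γ i) ≠ φ (γ (i + 1))) ∧
  ∀ i j : ZMod t, i ≠ j →
    (j = i + 1 →
      segment ℝ (γ i) (γ (i + 1)) ∩ segment ℝ (γ j) (γ (j + 1)) = ({γ (i + 1)} : Set Pt)) ∧
    (j ≠ i + 1 → i ≠ j + 1 →
      segment ℝ (γ i) (γ (i + 1)) ∩ segment ℝ (γ j) (γ (j + 1)) = (∅ : Set Pt))

/-- A cycle is non-rainbow if some color appears on two of its points. -/
def NonRainbow (φ : Pt → ℕ) (t : ℕ) (γ : ZMod t → Pt) : Prop :=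
  ∃ i j : ZMod t, i ≠ j ∧ φ (γ i) = φ (γ j)

/-- A set of points is in convex position (each point is a vertex of the convex hull). -/
def ConvexPosition (s : Set Pt) : Prop :=
  ∀ p ∈ s, p ∉ convexHull ℝ (s \ {p})

/-- Configuration C1: two pairs of equally-colored points (two distinct colors), one pair
separated by the line through the other pair. -/
def ConfigC1 (P : Set Pt) (φ : Pt → ℕ) : Prop :=
  ∃ u u' v v' : Pt, u ∈ P ∧ u' ∈ P ∧ v ∈ P ∧ v' ∈ P ∧
    u ≠ u' ∧ u ≠ v ∧ u ≠ v' ∧ u' ≠ v ∧ u' ≠ v' ∧ v ≠ v' ∧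
    φ u = φ u' ∧ φ v = φ v' ∧ φ u ≠ φ v ∧
    StrictlyOppositeSides u u' v v'

/-- Configuration C2: a monochromatic pair `u, u'` whose line separates two points of two
further, pairwise distinct, colors. -/
def ConfigC2 (P : Set Pt) (φ : Pt → ℕ) : Prop :=
  ∃ u u' v v' : Pt, u ∈ P ∧ u' ∈ P ∧ v ∈ P ∧ v' ∈ P ∧
    u ≠ u' ∧ u ≠ v ∧ u ≠ v' ∧ u' ≠ v ∧ u' ≠ v' ∧ v ≠ v' ∧
    φ u = φ u' ∧ φ v ≠ φ v' ∧ φ u ≠ φ v ∧ φ u ≠ φ v' ∧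
    StrictlyOppositeSides u u' v v'

/-- Configuration C3: a monochromatic pair `v, v'` separated by the line through two points
`u, u'` of two further, pairwise distinct, colors. -/
def ConfigC3 (P : Set Pt) (φ : Pt → ℕ) : Prop :=
  ∃ u u' v v' : Pt, u ∈ P ∧ u' ∈ P ∧ v ∈ P ∧ v' ∈ P ∧
    u ≠ u' ∧ u ≠ v ∧ u ≠ v' ∧ u' ≠ v ∧ u' ≠ v' ∧ v ≠ v' ∧
    φ v = φ v' ∧ φ u ≠ φ u' ∧ φ v ≠ φ u ∧ φ v ≠ φ u' ∧
    StrictlyOppositeSides u u' v v'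

/-- Configuration C4: five points with four pairwise distinct colors (`u` and `u'` sharing a
color), where `u, u', v, v'` form a convex quadrilateral with `w` in its interior. -/
def ConfigC4 (P : Set Pt) (φ : Pt → ℕ) : Prop :=
  ∃ u u' v v' w : Pt, u ∈ P ∧ u' ∈ P ∧ v ∈ P ∧ v' ∈ P ∧ w ∈ P ∧
    u ≠ u' ∧ u ≠ v ∧ u ≠ v' ∧ u ≠ w ∧ u' ≠ v ∧ u' ≠ v' ∧ u' ≠ w ∧
    v ≠ v' ∧ v ≠ w ∧ v' ≠ w ∧
    φ u = φ u' ∧ φ u ≠ φ v ∧ φ u ≠ φ v' ∧ φ u ≠ φ w ∧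
    φ v ≠ φ v' ∧ φ v ≠ φ w ∧ φ v' ≠ φ w ∧
    ConvexPosition ({u, u', v, v'} : Set Pt) ∧
    w ∈ interior (convexHull ℝ ({u, u', v, v'} : Set Pt))

/-- `H = (P, φ)` contains a non-rainbow plane cycle. -/
def ContainsNonRainbowPlaneCycle (P : Set Pt) (φ : Pt → ℕ) : Prop :=
  ∃ t : ℕ, ∃ γ : ZMod t → Pt, IsPlaneCycle φ t γ ∧ (∀ i, γ i ∈ P) ∧ NonRainbow φ t γ

lemma ss_ne {P : Set Pt} (hgp : GenPos P) {a b c : Pt} (ha : a ∈ P) (hb : b ∈ P) (hc : c ∈ P)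
    (hab : a ≠ b) (hac : a ≠ c) (hbc : b ≠ c) : sideSign a b c ≠ 0 := by
  intro h
  apply hgp a ha b hb c hc hab hac hbc
  rw [collinear_iff_of_mem (p₀ := a) (by simp)]
  refine ⟨b - a, ?_⟩
  have key : ∃ r : ℝ, c = r • (b - a) +ᵥ a := by
    unfold sideSign at h
    by_cases h1 : b.1 - a.1 = 0
    · have h2 : b.2 - a.2 ≠ 0 := by
        intro h2
        apply hab
        ext <;> linarith
      refine ⟨(c.2 - a.2) / (b.2 - a.2), ?_⟩
      have h3 : c.1 - a.1 = 0 := by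
        rw [h1] at h
        have : (b.2 - a.2) * (c.1 - a.1) = 0 := by linarith
        exact (mul_eq_zero.mp this).resolve_left h2
      ext
      · simp [h1]; linarith
      · simp; field_simp; ring
    · refine ⟨(c.1 - a.1) / (b.1 - a.1), ?_⟩
      ext
      · simp; field_simp; ring
      · simp; field_simp; linarith
  intro p hp
  simp only [Set.mem_insert_iff, Set.mem_singleton_iff] at hp
  rcases hp with rfl | rfl | rfl
  · exact ⟨0, by simp⟩
  · exact ⟨1, by simp⟩
  · exact key

lemma seg_cross {p q x y : Pt} (h1 : sideSign p q x * sideSign p q y < 0)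
    (h2 : sideSign x y p * sideSign x y q < 0) :
    (segment ℝ p q ∩ segment ℝ x y).Nonempty := by
  have aux : ∀ s t : ℝ, s * t < 0 → s - t ≠ 0 ∧ 0 ≤ s / (s - t) ∧ 0 ≤ -t / (s - t) := by
    intro s t h
    rcases mul_neg_iff.mp h with ⟨a, b⟩ | ⟨a, b⟩
    · exact ⟨by linarith, div_nonneg (by linarith) (by linarith),
        div_nonneg (by linarith) (by linarith)⟩
    · exact ⟨by linarith, div_nonneg_of_nonpos (by linarith) (by linarith),
        div_nonneg_of_nonpos (by linarith) (by linarith)⟩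
  obtain ⟨n1, a1, b1⟩ := aux _ _ h1
  obtain ⟨n2, a2, b2⟩ := aux _ _ h2
  refine ⟨(-sideSign p q y / (sideSign p q x - sideSign p q y)) • x +
    (sideSign p q x / (sideSign p q x - sideSign p q y)) • y, ?_, ?_⟩
  · refine ⟨_, _, b2, a2, by field_simp; ring, ?_⟩
    ext
    · simp
      field_simp
      unfold sideSign
      ring
    · simp
      field_simp
      unfold sideSign
      ring
  · exact ⟨_, _, b1, a1, by field_simp; ring, rfl⟩

lemma not_mem_hull {p q r s : Pt} (h : 0 < sideSign p q r * sideSign p q s) :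
    p ∉ convexHull ℝ ({q, r, s} : Set Pt) := by
  intro hp
  rw [convexHull_insert (by simp), convexHull_pair] at hp
  simp only [convexJoin_singleton_left, Set.mem_iUnion] at hp
  obtain ⟨z, ⟨a, b, ha, hb, hab, rfl⟩, ⟨c, d, hc, hd, hcd, he⟩⟩ := hp
  have e1 : p.1 = c * q.1 + d * (a * r.1 + b * s.1) := by rw [← he]; simp; ring
  have e2 : p.2 = c * q.2 + d * (a * r.2 + b * s.2) := by rw [← he]; simp; ring
  have hz : d * (a * sideSign p q r + b * sideSign p q s) = 0 := by
    have h0 : c * sideSign p q q + d * (a * sideSign p q r + b * sideSign p q s)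
        = sideSign p q p := by
      have hb' : b = 1 - a := by linarith
      have hc' : c = 1 - d := by linarith
      unfold sideSign
      linear_combination (-(q.1 - p.1)) * e2 + (q.2 - p.2) * e1
        + (d * ((q.1 - p.1) * (-p.2) - (q.2 - p.2) * (-p.1))) * hab
        + ((q.1 - p.1) * (-p.2) - (q.2 - p.2) * (-p.1)) * hcd
    have h1 : sideSign p q q = 0 := by unfold sideSign; ring
    have h2 : sideSign p q p = 0 := by unfold sideSign; ring
    rw [h1, h2] at h0
    linarith
  have hne : a * sideSign p q r + b * sideSign p q s ≠ 0 := by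
    intro h0
    rcases mul_pos_iff.mp h with ⟨u, v⟩ | ⟨u, v⟩
    · have := mul_nonneg ha u.le
      have := mul_nonneg hb v.le
      have h3 : a * sideSign p q r = 0 := by linarith
      have h4 : b * sideSign p q s = 0 := by linarith
      have h5 := (mul_eq_zero.mp h3).resolve_right u.ne'
      have h6 := (mul_eq_zero.mp h4).resolve_right v.ne'
      linarith
    · have := mul_nonpos_of_nonneg_of_nonpos ha u.le
      have := mul_nonpos_of_nonneg_of_nonpos hb v.le
      have h3 : a * sideSign p q r = 0 := by linarith
      have h4 : b * sideSign p q s = 0 := by linarith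
      have h5 := (mul_eq_zero.mp h3).resolve_right u.ne
      have h6 := (mul_eq_zero.mp h4).resolve_right v.ne
      linarith
  have hd0 := (mul_eq_zero.mp hz).resolve_right hne
  have hpq : p = q := by
    have : c = 1 := by linarith
    subst hd0
    subst this
    ext <;> simp [e1, e2]
  subst hpq
  simp [sideSign] at h

lemma mem_interior_hull {b x y c c' : Pt} {S : Set Pt} (hx : x ∈ S) (hy : y ∈ S) (hc : c ∈ S)
    (hS : S = {c, c', x, y})
    (h1 : 0 < sideSign x y c * sideSign x y b) (h2 : 0 < sideSign x y c * sideSign y c b)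
    (h3 : 0 < sideSign x y c * sideSign c x b) : b ∈ interior (convexHull ℝ S) := by
  let U : Set Pt := {p | 0 < sideSign x y c * sideSign x y p ∧
    0 < sideSign x y c * sideSign y c p ∧ 0 < sideSign x y c * sideSign c x p}
  have hU : IsOpen U := by
    have hcont : ∀ u v : Pt, Continuous (fun p => sideSign x y c * sideSign u v p) := by
      intro u v; unfold sideSign; fun_prop
    exact (isOpen_lt continuous_const (hcont _ _)).inter
      ((isOpen_lt continuous_const (hcont _ _)).inter (isOpen_lt continuous_const (hcont _ _)))
  refine interior_maximal (s := convexHull ℝ S) ?_ hU ⟨h1, h2, h3⟩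
  rintro p ⟨g1, g2, g3⟩
  set R := sideSign x y c with hR
  have hne : R ≠ 0 := by rintro h; rw [h] at g1; simp at g1
  have pos : ∀ s, 0 < R * s → 0 ≤ s / R := by
    intro s hs
    have : s / R = (R * s) / (R * R) := by field_simp
    rw [this]
    exact div_nonneg hs.le (mul_self_nonneg R)
  have hsum : sideSign x y p / R + sideSign y c p / R + sideSign c x p / R = 1 := by
    field_simp
    rw [hR]; unfold sideSign; ring
  have hcomb : p = (sideSign x y p / R) • c + (sideSign y c p / R) • x
      + (sideSign c x p / R) • y := by
    ext
    · simp
      field_simp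
      rw [hR]; unfold sideSign; ring
    · simp
      field_simp
      rw [hR]; unfold sideSign; ring
  rw [hcomb]
  have hconv := convex_convexHull ℝ S
  have := hconv.sum_mem (t := (Finset.univ : Finset (Fin 3)))
    (w := ![sideSign x y p / R, sideSign y c p / R, sideSign c x p / R])
    (z := ![c, x, y])
    (by intro i _; fin_cases i
        · exact pos _ g1
        · exact pos _ g2
        · exact pos _ g3)
    (by rw [Fin.sum_univ_three]; exact hsum)
    (by intro i _; fin_cases i
        · exact subset_convexHull ℝ S hc
        · exact subset_convexHull ℝ S hx
        · exact subset_convexHull ℝ S hy)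
  rw [Fin.sum_univ_three] at this
  exact this

lemma pos_of {a b : ℝ} (ha : a ≠ 0) (hb : b ≠ 0) (h : ¬ a * b < 0) : 0 < a * b :=
  lt_of_le_of_ne (not_lt.mp h) (mul_ne_zero ha hb).symm

lemma main_cycle (P : Set Pt) (φ : Pt → ℕ) (hgp : GenPos P)
    (H1 : ∀ u ∈ P, ∀ u' ∈ P, ∀ v ∈ P, ∀ v' ∈ P, u ≠ u' → φ u = φ u' → φ u ≠ φ v → φ u ≠ φ v' →
      0 < sideSign u u' v * sideSign u u' v')
    (H2 : ∀ u ∈ P, ∀ u' ∈ P, ∀ v ∈ P, ∀ v' ∈ P, u ≠ u' → v ≠ v' → φ v = φ v' → φ v ≠ φ u →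
      φ v ≠ φ u' → 0 < sideSign u u' v * sideSign u u' v')
    (t : ℕ) (ht : 3 ≤ t) (γ : ZMod t → Pt) (hP : ∀ i, γ i ∈ P) (hinj : Function.Injective γ)
    (hcol : ∀ i, φ (γ i) ≠ φ (γ (i + 1)))
    (hdis : ∀ i j : ZMod t, i ≠ j → j ≠ i + 1 → i ≠ j + 1 →
      segment ℝ (γ i) (γ (i + 1)) ∩ segment ℝ (γ j) (γ (j + 1)) = (∅ : Set Pt))
    (i j : ZMod t) (hij : i ≠ j) (hφ : φ (γ i) = φ (γ j))
    (hs : sideSign (γ i) (γ (i - 1)) (γ j) * sideSign (γ i) (γ (i - 1)) (γ (i + 1)) < 0) :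
    ConfigC4 P φ := by
  have : NeZero t := ⟨by omega⟩
  set c1 := γ i with hc1
  set c2 := γ j with hc2
  set b := γ (i - 1) with hb
  have hcb : φ c1 ≠ φ b := by
    have := hcol (i - 1)
    rw [sub_add_cancel] at this
    exact this.symm
  have hji : j ≠ i - 1 := by
    intro h
    apply hcb
    rw [hφ, hc2, h]
  have hcast : ∀ k : ℕ, 0 < k → k < t → (k : ZMod t) ≠ 0 := by
    intro k h0 h1 h
    rw [ZMod.natCast_eq_zero_iff] at h
    exact absurd (Nat.le_of_dvd h0 h) (by omega)
  set n := (j - i).val with hn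
  have hnj : (n : ZMod t) = j - i := by rw [hn]; exact ZMod.natCast_zmod_val _
  have hnt : n < t := ZMod.val_lt _
  have hn0 : n ≠ 0 := by
    intro h
    rw [h] at hnj
    apply hij
    have : j - i = 0 := by rw [← hnj]; simp
    exact (sub_eq_zero.mp this).symm
  have hnt' : n + 1 < t := by
    rcases Nat.lt_or_ge (n + 1) t with h | h
    · exact h
    · exfalso
      have h1 : n + 1 = t := by omega
      apply hji
      have h2 : ((n + 1 : ℕ) : ZMod t) = 0 := by rw [h1]; simp
      push_cast at h2
      rw [hnj] at h2
      linear_combination h2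
  have hk1 : ∀ k : ℕ, 1 ≤ k → k ≤ n → i + (k : ZMod t) ≠ i := by
    intro k h1 h2 h
    exact hcast k (by omega) (by omega) (by linear_combination h)
  have hk2 : ∀ k : ℕ, 1 ≤ k → k ≤ n → i + (k : ZMod t) ≠ i - 1 := by
    intro k h1 h2 h
    exact hcast (k + 1) (by omega) (by omega) (by push_cast; linear_combination h)
  have hcne : c1 ≠ b := fun h => hcb (by rw [h])
  have hgne : ∀ k : ℕ, 1 ≤ k → k ≤ n → sideSign c1 b (γ (i + k)) ≠ 0 := by
    intro k h1 h2
    exact ss_ne hgp (hP _) (hP _) (hP _) hcne (fun h => hk1 k h1 h2 (hinj h).symm)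
      (fun h => hk2 k h1 h2 (hinj h).symm)
  have hex : ∃ k : ℕ, 1 ≤ k ∧ k + 1 ≤ n ∧
      sideSign c1 b (γ (i + k)) * sideSign c1 b (γ (i + (k + 1 : ℕ))) < 0 := by
    by_contra hcon
    push Not at hcon
    have hall : ∀ k : ℕ, 1 ≤ k → k ≤ n →
        0 < sideSign c1 b (γ (i + k)) * sideSign c1 b (γ (i + 1)) := by
      intro k h1
      induction k, h1 using Nat.le_induction with
      | base =>
        intro h2
        have := hgne 1 le_rfl h2
        rw [Nat.cast_one] at this ⊢
        exact mul_self_pos.mpr this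
      | succ k h1 ih =>
        intro h2
        have e1 := ih (by omega)
        have e2 : 0 < sideSign c1 b (γ (i + k)) * sideSign c1 b (γ (i + (k + 1 : ℕ))) :=
          pos_of (hgne k h1 (by omega)) (hgne (k + 1) (by omega) h2) (not_lt.mpr (hcon k h1 h2))
        have e3 := mul_pos e1 e2
        by_contra hneg
        push Not at hneg
        nlinarith [mul_self_nonneg (sideSign c1 b (γ (i + k)))]
    have := hall n (by omega) le_rfl
    rw [hnj, add_sub_cancel] at this
    exact absurd hs (not_lt.mpr this.le)
  obtain ⟨k, hk, hkn, hxy⟩ := hex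
  have hyk : i + ((k + 1 : ℕ) : ZMod t) = i + k + 1 := by push_cast; ring
  have hx1 := hk1 k hk (by omega)
  have hx2 := hk2 k hk (by omega)
  have hy1 := hk1 (k + 1) (by omega) hkn
  have hy2 := hk2 (k + 1) (by omega) hkn
  rw [hyk] at hxy hy1 hy2
  have hdisj := hdis (i - 1) (i + k) hx2.symm (by rwa [sub_add_cancel]) hy2.symm
  rw [sub_add_cancel] at hdisj
  have hcxy := hcol (i + k)
  have hxP := hP (i + k)
  have hyP := hP (i + k + 1)
  have hxc : γ (i + k) ≠ c1 := fun h => hx1 (hinj h)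
  have hxb : γ (i + k) ≠ b := fun h => hx2 (hinj h)
  have hyc : γ (i + k + 1) ≠ c1 := fun h => hy1 (hinj h)
  have hyb : γ (i + k + 1) ≠ b := fun h => hy2 (hinj h)
  generalize γ (i + k) = x at *
  generalize γ (i + k + 1) = y at *
  have hc1P : c1 ∈ P := hP _
  have hc2P : c2 ∈ P := hP _
  have hbP : b ∈ P := hP _
  have hcc : c1 ≠ c2 := fun h => hij (hinj h)
  have hxyne : x ≠ y := fun h => hcxy (by rw [h])
  have hncross : ¬ sideSign x y c1 * sideSign x y b < 0 := by
    intro h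
    obtain ⟨z, hz1, hz2⟩ := seg_cross hxy h
    have : z ∈ segment ℝ b c1 ∩ segment ℝ x y := ⟨by rw [segment_symm]; exact hz1, hz2⟩
    rw [hdisj] at this
    exact this
  clear_value c1 c2 b n
  -- neither x nor y has color of c1
  have hmix : ∀ x y : Pt, x ∈ P → y ∈ P → x ≠ c1 → y ≠ b →
      sideSign c1 b x * sideSign c1 b y < 0 → φ x = φ c1 → φ y ≠ φ c1 →
      sideSign x y c1 * sideSign x y b < 0 := by
    intro x y hxP hyP hxc hyb hxy e1 e2
    have a1 := H1 c1 hc1P x hxP b hbP y hyP hxc.symm e1.symm hcb e2.symm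
    have a2 := H2 b hbP y hyP c1 hc1P x hxP hyb.symm hxc.symm e1.symm hcb e2.symm
    have r1 : sideSign b y c1 = sideSign c1 b y := by unfold sideSign; ring
    have r2 : sideSign c1 b x = - sideSign c1 x b := by unfold sideSign; ring
    have r3 : sideSign x y c1 = sideSign c1 x y := by unfold sideSign; ring
    have r4 : sideSign x y b = - sideSign b y x := by unfold sideSign; ring
    rw [r1] at a2
    rw [r2] at hxy
    rw [r3, r4]
    generalize sideSign c1 x b = α at *
    generalize sideSign c1 x y = β at *
    generalize sideSign c1 b y = g at *
    generalize sideSign b y x = δ at *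
    have h3 : 0 < α * g := by linarith
    rcases mul_pos_iff.mp a1 with ⟨u, v⟩ | ⟨u, v⟩
    · have := (mul_pos_iff_of_pos_left u).mp h3
      have := (mul_pos_iff_of_pos_left this).mp a2
      nlinarith
    · have := neg_of_mul_pos_right h3 u.le
      have := neg_of_mul_pos_right a2 this.le
      nlinarith
  have hxcol : φ x ≠ φ c1 := fun e =>
    hncross (hmix x y hxP hyP hxc hyb hxy e (fun e' => hcxy (e.trans e'.symm)))
  have hycol : φ y ≠ φ c1 := by
    intro e
    have := hmix y x hyP hxP hyc hxb (by linarith) e hxcol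
    have r1 : ∀ p, sideSign y x p = - sideSign x y p := by intro p; unfold sideSign; ring
    rw [r1, r1] at this
    exact hncross (by linarith)
  have hR0 := ss_ne hgp hxP hyP hc1P hxyne hxc hyc
  have hr0 := ss_ne hgp hxP hyP hbP hxyne hxb hyb
  have hrR := pos_of hR0 hr0 hncross
  have f1 := H1 c1 hc1P c2 hc2P b hbP x hxP hcc hφ hcb hxcol.symm
  have f2 := H1 c1 hc1P c2 hc2P b hbP y hyP hcc hφ hcb hycol.symm
  have f3 := H1 c1 hc1P c2 hc2P x hxP y hyP hcc hφ hxcol.symm hycol.symm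
  have f4 := H2 x hxP y hyP c1 hc1P c2 hc2P hxyne hcc hφ hxcol.symm hycol.symm
  have hid : sideSign x y c1 * sideSign c1 c2 b =
      sideSign c1 b y * sideSign c1 c2 x - sideSign c1 b x * sideSign c1 c2 y := by
    unfold sideSign; ring
  -- signs
  have s1 : 0 < sideSign x y c1 * sideSign c1 b y ∧ 0 < sideSign x y c1 * (- sideSign c1 b x) := by
    generalize sideSign x y c1 = R at *
    generalize sideSign c1 b y = q at *
    generalize sideSign c1 b x = p at *
    generalize sideSign c1 c2 b = fb at *
    generalize sideSign c1 c2 x = fx at *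
    generalize sideSign c1 c2 y = fy at *
    have hid2 : R * (fb * fb) = q * (fb * fx) - p * (fb * fy) := by linear_combination fb * hid
    have hfb : 0 < fb * fb := by
      have : fb ≠ 0 := by rintro rfl; simp at f1
      exact mul_self_pos.mpr this
    rcases mul_neg_iff.mp hxy with ⟨u, v⟩ | ⟨u, v⟩
    · have a1 := mul_neg_of_neg_of_pos v f1
      have a2 := mul_pos u f2
      have hR : R < 0 := by
        by_contra hh
        have := mul_nonneg (not_lt.mp hh) hfb.le
        linarith
      exact ⟨mul_pos_of_neg_of_neg hR v, mul_pos_of_neg_of_neg hR (by linarith)⟩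
    · have a1 := mul_pos v f1
      have a2 := mul_neg_of_neg_of_pos u f2
      have hR : 0 < R := by
        by_contra hh
        have := mul_nonpos_of_nonpos_of_nonneg (not_lt.mp hh) hfb.le
        linarith
      exact ⟨mul_pos hR v, mul_pos hR (by linarith)⟩
  have same : ∀ R r q : ℝ, 0 < R * r → 0 < R * q → 0 < r * q := by
    intro R r q h1 h2
    rcases mul_pos_iff.mp h1 with ⟨u, v⟩ | ⟨u, v⟩
    · exact mul_pos v ((mul_pos_iff_of_pos_left u).mp h2)
    · exact mul_pos_of_neg_of_neg v (neg_of_mul_pos_right h2 u.le)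
  have hbx : φ b ≠ φ x := by
    intro e
    have := H1 b hbP x hxP c1 hc1P y hyP hxb.symm e hcb.symm (by rw [e]; exact hcxy)
    have r1 : sideSign b x c1 = sideSign c1 b x := by unfold sideSign; ring
    have r2 : sideSign b x y = sideSign x y b := by unfold sideSign; ring
    rw [r1, r2] at this
    have := same _ _ _ hrR s1.2
    linarith
  have hby : φ b ≠ φ y := by
    intro e
    have := H1 b hbP y hyP c1 hc1P x hxP hyb.symm e hcb.symm (by rw [e]; exact hcxy.symm)
    have r1 : sideSign b y c1 = sideSign c1 b y := by unfold sideSign; ring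
    have r2 : sideSign b y x = - sideSign x y b := by unfold sideSign; ring
    rw [r1, r2] at this
    have := same _ _ _ hrR s1.1
    linarith
  have hc2x : c2 ≠ x := fun h => hxcol (by rw [← h, hφ])
  have hc2y : c2 ≠ y := fun h => hycol (by rw [← h, hφ])
  have hc2b : c2 ≠ b := fun h => hcb (by rw [← h, hφ])
  refine ⟨c1, c2, x, y, b, hc1P, hc2P, hxP, hyP, hbP, hcc, hxc.symm, hyc.symm, hcne, hc2x, hc2y,
    hc2b, hxyne, hxb, hyb, hφ, hxcol.symm, hycol.symm, hcb, hcxy, hbx.symm, hby.symm, ?_, ?_⟩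
  · intro p hp hmem
    have hsub : ∀ q r s : Pt, ({c1, c2, x, y} : Set Pt) \ {p} ⊆ {q, r, s} →
        0 < sideSign p q r * sideSign p q s → False := fun q r s hss hpos =>
      not_mem_hull hpos (convexHull_mono hss hmem)
    simp only [Set.mem_insert_iff, Set.mem_singleton_iff] at hp
    have anti : ∀ u v w : Pt, sideSign v u w = - sideSign u v w := by
      intro u v w; unfold sideSign; ring
    rcases hp with rfl | rfl | rfl | rfl
    · refine hsub c2 x y ?_ f3
      rintro z ⟨hz, hz'⟩; simp at hz hz' ⊢; tauto
    · refine hsub c1 x y ?_ (by rw [anti c1, anti c1]; linarith)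
      rintro z ⟨hz, hz'⟩; simp at hz hz' ⊢; tauto
    · refine hsub y c1 c2 ?_ f4
      rintro z ⟨hz, hz'⟩; simp at hz hz' ⊢; tauto
    · refine hsub x c1 c2 ?_ (by rw [anti x, anti x]; linarith)
      rintro z ⟨hz, hz'⟩; simp at hz hz' ⊢; tauto
  · refine mem_interior_hull (x := x) (y := y) (c := c1) (c' := c2) (by simp) (by simp) (by simp)
      rfl hrR ?_ ?_
    · have : sideSign y c1 b = sideSign c1 b y := by unfold sideSign; ring
      rw [this]; exact s1.1
    · have : sideSign c1 x b = - sideSign c1 b x := by unfold sideSign; ring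
      rw [this]; exact s1.2

/-- if a geometric complete multipartite graph contains a non-rainbow plane
cycle, then it contains one of the configurations C1 -- C4. -/
theorem stmt_3 (P : Set Pt) (φ : Pt → ℕ) (hfin : P.Finite) (hgp : GenPos P)
    (h : ContainsNonRainbowPlaneCycle P φ) :
    ConfigC1 P φ ∨ ConfigC2 P φ ∨ ConfigC3 P φ ∨ ConfigC4 P φ := by
  by_contra hcon
  push Not at hcon
  obtain ⟨h1, h2, h3, h4⟩ := hcon
  obtain ⟨t, γ, ⟨ht, hinj, hcol, hseg⟩, hP, i, j, hij, hφ⟩ := h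
  have hne : ∀ {p q : Pt}, φ p ≠ φ q → p ≠ q := fun h e => h (by rw [e])
  have H1 : ∀ u ∈ P, ∀ u' ∈ P, ∀ v ∈ P, ∀ v' ∈ P, u ≠ u' → φ u = φ u' → φ u ≠ φ v →
      φ u ≠ φ v' → 0 < sideSign u u' v * sideSign u u' v' := by
    intro u hu u' hu' v hv v' hv' huu e e1 e2
    have e1' : φ u' ≠ φ v := e ▸ e1
    have e2' : φ u' ≠ φ v' := e ▸ e2
    refine pos_of (ss_ne hgp hu hu' hv huu (hne e1) (hne e1'))
      (ss_ne hgp hu hu' hv' huu (hne e2) (hne e2')) ?_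
    intro hneg
    have hvv : v ≠ v' := by
      rintro rfl
      exact absurd hneg (not_lt.mpr (mul_self_nonneg _))
    by_cases hc : φ v = φ v'
    · exact h1 ⟨u, u', v, v', hu, hu', hv, hv', huu, hne e1, hne e2, hne e1', hne e2', hvv, e, hc,
        e1, hneg⟩
    · exact h2 ⟨u, u', v, v', hu, hu', hv, hv', huu, hne e1, hne e2, hne e1', hne e2', hvv, e, hc,
        e1, e2, hneg⟩
  have H2 : ∀ u ∈ P, ∀ u' ∈ P, ∀ v ∈ P, ∀ v' ∈ P, u ≠ u' → v ≠ v' → φ v = φ v' → φ v ≠ φ u →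
      φ v ≠ φ u' → 0 < sideSign u u' v * sideSign u u' v' := by
    intro u hu u' hu' v hv v' hv' huu hvv e e1 e2
    have e1' : φ v' ≠ φ u := e ▸ e1
    have e2' : φ v' ≠ φ u' := e ▸ e2
    refine pos_of (ss_ne hgp hu hu' hv huu (hne e1.symm) (hne e2.symm))
      (ss_ne hgp hu hu' hv' huu (hne e1'.symm) (hne e2'.symm)) ?_
    intro hneg
    by_cases hc : φ u = φ u'
    · exact h1 ⟨u, u', v, v', hu, hu', hv, hv', huu, hne e1.symm, hne e1'.symm, hne e2.symm,
        hne e2'.symm, hvv, hc, e, e1.symm, hneg⟩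
    · exact h3 ⟨u, u', v, v', hu, hu', hv, hv', huu, hne e1.symm, hne e1'.symm, hne e2.symm,
        hne e2'.symm, hvv, e, hc, e1, e2, hneg⟩
  have : NeZero t := ⟨by omega⟩
  have htwo : (2 : ZMod t) ≠ 0 := by
    intro h
    have h' : ((2 : ℕ) : ZMod t) = 0 := by exact_mod_cast h
    rw [ZMod.natCast_eq_zero_iff] at h'
    exact absurd (Nat.le_of_dvd (by norm_num) h') (by omega)
  have ha := hcol i
  have hb : φ (γ i) ≠ φ (γ (i - 1)) := by
    have := hcol (i - 1)
    rw [sub_add_cancel] at this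
    exact this.symm
  have hcc : γ i ≠ γ j := fun h => hij (hinj h)
  have hab : γ (i + 1) ≠ γ (i - 1) := by
    intro h
    apply htwo
    linear_combination hinj h
  have s := H1 _ (hP i) _ (hP j) _ (hP (i + 1)) _ (hP (i - 1)) hcc hφ ha hb
  have d0 := ss_ne hgp (hP i) (hP (i + 1)) (hP (i - 1)) (hne ha) (hne hb) hab
  have key : sideSign (γ i) (γ (i - 1)) (γ j) * sideSign (γ i) (γ (i - 1)) (γ (i + 1)) < 0 ∨
      sideSign (γ i) (γ (i + 1)) (γ j) * sideSign (γ i) (γ (i + 1)) (γ (i - 1)) < 0 := by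
    have r1 : sideSign (γ i) (γ (i - 1)) (γ j) = - sideSign (γ i) (γ j) (γ (i - 1)) := by
      unfold sideSign; ring
    have r2 : sideSign (γ i) (γ (i + 1)) (γ j) = - sideSign (γ i) (γ j) (γ (i + 1)) := by
      unfold sideSign; ring
    have r3 : sideSign (γ i) (γ (i - 1)) (γ (i + 1)) =
        - sideSign (γ i) (γ (i + 1)) (γ (i - 1)) := by
      unfold sideSign; ring
    rw [r1, r2, r3]
    generalize sideSign (γ i) (γ (i + 1)) (γ (i - 1)) = D at *
    rcases mul_pos_iff.mp s with ⟨u, v⟩ | ⟨u, v⟩ <;> rcases lt_or_gt_of_ne d0 with w | w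
    · left; nlinarith
    · right; nlinarith
    · right; nlinarith
    · left; nlinarith
  rcases key with key | key
  · exact h4 (main_cycle P φ hgp H1 H2 t ht γ hP hinj hcol
      (fun a b h1 h2 h3 => (hseg a b h1).2 h2 h3) i j hij hφ key)
  · refine h4 (main_cycle P φ hgp H1 H2 t ht (fun k => γ (-k)) (fun _ => hP _)
      (fun a b h => neg_injective (hinj h)) ?_ ?_ (-i) (-j) (fun h => hij (neg_injective h)) ?_ ?_)
    · intro k
      have := hcol (-(k + 1))
      rw [show -(k + 1) + 1 = -k by ring] at this
      exact this.symm
    · intro a b h1 h2 h3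
      have := (hseg (-(a + 1)) (-(b + 1)) (fun h => h1 (by linear_combination -h))).2
        (fun h => h3 (by linear_combination h)) (fun h => h2 (by linear_combination h))
      rw [show -(a + 1) + 1 = -a by ring, show -(b + 1) + 1 = -b by ring] at this
      rw [segment_symm ℝ (γ (-a)), segment_symm ℝ (γ (-b))]
      exact this
    · simpa using hφ
    · simp only [neg_neg]
      rw [show -(-i - 1) = i + 1 by ring, show -(-i + 1) = i - 1 by ring]
      exact key
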